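/- Fix an integer τ with 0 ≤ τ and a degree bound c. If β is the Betti table of a MINIMAL graded free resolution of a finitely generated graded S-module, and E: 0 → E^0 → ... → E^n → 0 is any complex of graded free S-modules with cohomology table γ_{j,d} = dim_K (H^j(E))_d, then ⟨β, γ⟩_{c,τ} ≥ 0, where ⟨β, γ⟩_{c,τ} = Σ_{{i,j,k : j ≤ i and (j < τ or j ≤ i−2)}} (−1)^{i−j} β_{i,k} γ_{j,−k} + Σ_{{k, ε ∈ {0,1} : k ≤ c+ε}} (−1)^{ε} β_{τ+ε,k} γ_{τ,−k}. -/

import Mathlib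

open MvPolynomial Finset Module

noncomputable section

/-- The standard graded polynomial ring `S = K[x_1, …, x_n]`. -/
abbrev PolyS (K : Type) [Field K] (n : ℕ) : Type := MvPolynomial (Fin n) K

/-- The `K`-subspace of homogeneous polynomials of integer degree `z`
(it is `0` if `z < 0`). -/
def homogZ (K : Type) [Field K] (n : ℕ) (z : ℤ) : Submodule K (PolyS K n) :=
  ⨆ (_ : 0 ≤ z), MvPolynomial.homogeneousSubmodule (Fin n) K z.toNat

/-- The degree-`ℓ` piece of the graded free module `⊕ₚ S(-dg p)`. -/
def freePiece {K : Type} [Field K] {n r : ℕ} (dg : Fin r → ℤ) (ℓ : ℤ) :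
    Submodule K (Fin r → PolyS K n) :=
  Submodule.pi Set.univ fun p => homogZ K n (ℓ - dg p)

/-- A (homologically indexed) finite complex of graded free `S`-modules
`F₀ ← F₁ ← ⋯ ← F_len ← 0`, where `Fᵢ = ⊕ₚ S(-deg i p)` and the (degree `0`)
map `Fᵢ₊₁ → Fᵢ` is given by the matrix `dd i`, whose entries are homogeneous
of the appropriate degrees. -/
structure FreeComplex (K : Type) [Field K] (n : ℕ) where
  len : ℕ
  rk : ℕ → ℕ
  deg : (i : ℕ) → Fin (rk i) → ℤ
  dd : (i : ℕ) → Matrix (Fin (rk i)) (Fin (rk (i+1))) (PolyS K n)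
  rk_eq_zero : ∀ i, len < i → rk i = 0
  isHomog : ∀ i p q, dd i p q ∈ homogZ K n (deg (i+1) q - deg i p)
  isComplex : ∀ i, dd i * dd (i+1) = 0

variable {K : Type} [Field K] {n : ℕ}

/-- `F` is exact in positive homological degrees; that is, it is a graded free
resolution of the finitely generated graded module `M = coker (F₁ → F₀)`. -/
def IsResolution (F : FreeComplex K n) : Prop :=
  ∀ i, LinearMap.ker ((F.dd i).mulVecLin) = LinearMap.range ((F.dd (i+1)).mulVecLin)

/-- The complex is minimal: entries of the differentials lie in the maximal ideal,
i.e. all (constant) entries between generators of equal degrees vanish. -/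
def IsMinimal (F : FreeComplex K n) : Prop :=
  ∀ i p q, F.deg (i+1) q = F.deg i p → F.dd i p q = 0

/-- Betti number `β_{i,j}`: the number of generators of `Fᵢ` of degree `j`. -/
def bettiNum (F : FreeComplex K n) (i : ℕ) (j : ℤ) : ℕ :=
  (Finset.univ.filter fun p => F.deg i p = j).card

/-- The dimension of the degree-`ℓ` piece of the module `M = coker (F₁ → F₀)`
resolved by `F`. -/
def MPieceDim (F : FreeComplex K n) (ℓ : ℤ) : ℕ :=
  finrank K ((freePiece (F.deg 0) ℓ) ⧸
    (Submodule.comap (freePiece (F.deg 0) ℓ).subtype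
      ((LinearMap.range ((F.dd 0).mulVecLin)).restrictScalars K)))

/-- The Hilbert polynomial of the twisted free module `S(-a)` in `n` variables:
`binom (t - a + n - 1, n - 1)`. -/
def genHilb (n : ℕ) (a : ℤ) : Polynomial ℚ :=
  if n = 0 then 0 else
    Polynomial.C (((n - 1).factorial : ℚ))⁻¹ *
      ∏ k ∈ Finset.range (n - 1),
        (Polynomial.X - Polynomial.C (a : ℚ) + Polynomial.C ((k : ℚ) + 1))

/-- The Hilbert polynomial of `M = coker (F₁ → F₀)`, computed from the free
resolution `F` by additivity. -/
def hilbPoly (F : FreeComplex K n) : Polynomial ℚ :=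
  ∑ i ∈ Finset.range (F.len + 1),
    Polynomial.C ((-1 : ℚ) ^ i) * ∑ p : Fin (F.rk i), genHilb n (F.deg i p)

/-- The Krull dimension of a module read off from its Hilbert polynomial:
`0` for the zero polynomial (finite length), `deg + 1` otherwise. -/
def polyDim (P : Polynomial ℚ) : ℕ := if P = 0 then 0 else P.natDegree + 1

/-- `M = coker (F₁ → F₀)` is a Cohen-Macaulay module of codimension `c`:
`F` is a minimal free resolution of length exactly `c` (so `pd M = c`, and by
Auslander–Buchsbaum `depth M = n - c`) and `dim M = n - c`. -/
def IsCMcodim (F : FreeComplex K n) (c : ℕ) : Prop :=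
  IsResolution F ∧ IsMinimal F ∧ (∀ i, c < i → F.rk i = 0) ∧ F.rk c ≠ 0 ∧
    polyDim (hilbPoly F) = n - c

/-- The multiplicity `e(M)` of a module of codimension `c`, computed from the
Betti numbers of a free resolution:
`e(M) = ((-1)^c / c!) ⬝ Σ_{i,j} (-1)^i β_{i,j} j^c`. -/
def multQ (F : FreeComplex K n) (c : ℕ) : ℚ :=
  ((-1 : ℚ) ^ c / c.factorial) *
    ∑ i ∈ Finset.range (F.len + 1),
      (-1 : ℚ) ^ i * ∑ p : Fin (F.rk i), ((F.deg i p : ℚ)) ^ c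


/-- A (cohomologically indexed) finite complex of graded free `S`-modules
`0 → E⁰ → E¹ → ⋯ → E^len → 0`, where `Eⁱ = ⊕ₚ S(-deg i p)` and the (degree `0`)
map `Eⁱ → Eⁱ⁺¹` is given by the matrix `dd i`. -/
structure CoComplex (K : Type) [Field K] (n : ℕ) where
  len : ℕ
  rk : ℕ → ℕ
  deg : (i : ℕ) → Fin (rk i) → ℤ
  dd : (i : ℕ) → Matrix (Fin (rk (i+1))) (Fin (rk i)) (PolyS K n)
  rk_eq_zero : ∀ i, len < i → rk i = 0
  isHomog : ∀ i p q, dd i p q ∈ homogZ K n (deg i q - deg (i+1) p)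
  isComplex : ∀ i, dd (i+1) * dd i = 0

/-- The degree-`ℓ` part of the cocycles at cohomological position `i`. -/
def CoComplex.kerPiece (E : CoComplex K n) (i : ℕ) (ℓ : ℤ) :
    Submodule K (Fin (E.rk i) → PolyS K n) :=
  ((LinearMap.ker ((E.dd i).mulVecLin)).restrictScalars K) ⊓ freePiece (E.deg i) ℓ

/-- The coboundaries at cohomological position `i` (as a `K`-subspace). -/
def CoComplex.imSub (E : CoComplex K n) : (i : ℕ) → Submodule K (Fin (E.rk i) → PolyS K n)
  | 0 => ⊥
  | (j+1) => (LinearMap.range ((E.dd j).mulVecLin)).restrictScalars K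

/-- `dim_K (Hⁱ(E))_ℓ`, the dimension of the degree-`ℓ` component of the `i`-th
cohomology module of the complex `E`. -/
def cohomDim (E : CoComplex K n) (i : ℕ) (ℓ : ℤ) : ℕ :=
  finrank K ((E.kerPiece i ℓ) ⧸
    (Submodule.comap (E.kerPiece i ℓ).subtype (E.imSub i)))

/-- The bilinear pairing `⟨F, E⟩ = Σ_{j ≤ i, k} (-1)^{i-j} β_{i,k}(F) ⬝ dim_K (H^j E)_{-k}`
of a free resolution `F` against a free cocomplex `E`. -/
def pairing (F : FreeComplex K n) (E : CoComplex K n) : ℤ :=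
  ∑ i ∈ Finset.range (F.len + 1), ∑ j ∈ Finset.range (i + 1),
    (-1 : ℤ) ^ (i - j) * ∑ p : Fin (F.rk i), (cohomDim E j (-(F.deg i p)) : ℤ)

/-- The modified pairing `⟨F, E⟩_{c,τ}`: terms with `j ≤ i` are kept when `j < τ`
or `j ≤ i - 2`, and the terms with `j = τ`, `i = τ + ε` (`ε ∈ {0,1}`) are kept
only when the degree `k` of the generator satisfies `k ≤ c + ε`. -/
def pairingMod (F : FreeComplex K n) (E : CoComplex K n) (c : ℤ) (τ : ℕ) : ℤ :=
  (∑ i ∈ Finset.range (F.len + 1), ∑ j ∈ Finset.range (i + 1),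
    if j < τ ∨ j + 2 ≤ i then
      (-1 : ℤ) ^ (i - j) * ∑ p : Fin (F.rk i), (cohomDim E j (-(F.deg i p)) : ℤ)
    else 0) +
  ∑ ε ∈ Finset.range 2,
    (-1 : ℤ) ^ ε * ∑ p ∈ Finset.univ.filter (fun p => F.deg (τ + ε) p ≤ c + ε),
      (cohomDim E τ (-(F.deg (τ + ε) p)) : ℤ)



section AbstractPart

theorem aux_finrank_step {V W : Type} [AddCommGroup V] [Module K V] [AddCommGroup W] [Module K W]
    [FiniteDimensional K V] (P : Submodule K V) (f : V →ₗ[K] W) :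
    finrank K P = finrank K (P.map f) + finrank K (P ⊓ LinearMap.ker f : Submodule K V) := by
  have h := LinearMap.finrank_range_add_finrank_ker (f.domRestrict P)
  rw [← h, LinearMap.range_domRestrict, LinearMap.ker_domRestrict]
  congr 1
  have e := Submodule.finrank_map_subtype_eq P ((LinearMap.ker f).comap P.subtype)
  rw [Submodule.map_comap_subtype] at e
  exact e.symm

variable {V : ℕ → Type} [∀ j, AddCommGroup (V j)] [∀ j, Module K (V j)]

/-- sequences supported in indices `< n`. -/
def auxHi (K : Type) [Field K] (V : ℕ → Type) [∀ j, AddCommGroup (V j)] [∀ j, Module K (V j)]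
    (n : ℕ) : Submodule K (∀ j, V j) where
  carrier := {u | ∀ k, n ≤ k → u k = 0}
  add_mem' := by
    intro a b ha hb k hk
    simp [ha k hk, hb k hk]
  zero_mem' := by intro k hk; rfl
  smul_mem' := by
    intro c a ha k hk
    simp [ha k hk]

/-- sequences supported in indices `≥ n`. -/
def auxLo (K : Type) [Field K] (V : ℕ → Type) [∀ j, AddCommGroup (V j)] [∀ j, Module K (V j)]
    (n : ℕ) : Submodule K (∀ j, V j) where
  carrier := {u | ∀ k, k < n → u k = 0}
  add_mem' := by
    intro a b ha hb k hk
    simp [ha k hk, hb k hk]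
  zero_mem' := by intro k hk; rfl
  smul_mem' := by
    intro c a ha k hk
    simp [ha k hk]

theorem mem_auxHi (n : ℕ) (u : ∀ j, V j) : u ∈ auxHi K V n ↔ ∀ k, n ≤ k → u k = 0 := Iff.rfl
theorem mem_auxLo (n : ℕ) (u : ∀ j, V j) : u ∈ auxLo K V n ↔ ∀ k, k < n → u k = 0 := Iff.rfl

theorem aux_pi_finite [∀ j, FiniteDimensional K (V j)] (N : ℕ)
    (hN : ∀ j, N ≤ j → Subsingleton (V j)) : FiniteDimensional K (∀ j, V j) := by
  let f : (∀ j, V j) →ₗ[K] (∀ j : Fin N, V j) := LinearMap.pi fun j => LinearMap.proj (j : ℕ)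
  refine Module.Finite.of_injective f ?_
  intro a b hab
  funext j
  by_cases hj : j < N
  · exact congrFun hab ⟨j, hj⟩
  · have := hN j (by omega)
    exact Subsingleton.elim _ _

theorem aux_hi_sum [FiniteDimensional K (∀ j, V j)] (U : Submodule K (∀ j, V j)) (n : ℕ) :
    finrank K (U ⊓ auxHi K V n : Submodule K _) =
      ∑ k ∈ range n, finrank K ((U ⊓ auxHi K V (k+1)).map (LinearMap.proj k : _ →ₗ[K] V k)) := by
  induction n with
  | zero =>
    have : U ⊓ auxHi K V 0 = ⊥ := by
      rw [eq_bot_iff]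
      rintro u ⟨_, hu⟩
      rw [Submodule.mem_bot]
      funext k
      exact hu k (Nat.zero_le _)
    simp [this]
  | succ n ih =>
    rw [sum_range_succ, ← ih, aux_finrank_step (U ⊓ auxHi K V (n+1)) (LinearMap.proj n : _ →ₗ[K] V n),
      add_comm]
    have : U ⊓ auxHi K V (n+1) ⊓ LinearMap.ker (LinearMap.proj n : _ →ₗ[K] V n) = U ⊓ auxHi K V n := by
      ext u
      simp only [Submodule.mem_inf, mem_auxHi, LinearMap.mem_ker, LinearMap.proj_apply]
      constructor
      · rintro ⟨⟨h1, h2⟩, h3⟩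
        refine ⟨h1, fun k hk => ?_⟩
        rcases eq_or_lt_of_le hk with rfl | h
        · exact h3
        · exact h2 k h
      · rintro ⟨h1, h2⟩
        exact ⟨⟨h1, fun k hk => h2 k (by omega)⟩, h2 n le_rfl⟩
    rw [this]

theorem aux_lo_sum [FiniteDimensional K (∀ j, V j)] (U : Submodule K (∀ j, V j)) (n : ℕ) :
    finrank K U = finrank K (U ⊓ auxLo K V n : Submodule K _) +
      ∑ k ∈ range n, finrank K ((U ⊓ auxLo K V k).map (LinearMap.proj k : _ →ₗ[K] V k)) := by
  induction n with
  | zero =>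
    have : U ⊓ auxLo K V 0 = U := by
      rw [inf_eq_left]
      intro u _ k hk
      omega
    rw [this]; simp
  | succ n ih =>
    rw [sum_range_succ, ih, aux_finrank_step (U ⊓ auxLo K V n) (LinearMap.proj n : _ →ₗ[K] V n)]
    have : U ⊓ auxLo K V n ⊓ LinearMap.ker (LinearMap.proj n : _ →ₗ[K] V n) = U ⊓ auxLo K V (n+1) := by
      ext u
      simp only [Submodule.mem_inf, mem_auxLo, LinearMap.mem_ker, LinearMap.proj_apply]
      constructor
      · rintro ⟨⟨h1, h2⟩, h3⟩
        refine ⟨h1, fun k hk => ?_⟩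
        rcases Nat.lt_succ_iff_lt_or_eq.1 hk with h | rfl
        · exact h2 k h
        · exact h3
      · rintro ⟨h1, h2⟩
        exact ⟨⟨h1, fun k hk => h2 k (by omega)⟩, h2 n (by omega)⟩
    rw [this]
    ring

variable {C : ℕ → ℕ → Type} [∀ i j, AddCommGroup (C i j)] [∀ i j, Module K (C i j)]

/-- coboundaries in the columns -/
def auxB (dE : ∀ i j, C i j →ₗ[K] C i (j+1)) (i : ℕ) : (j : ℕ) → Submodule K (C i j)
  | 0 => ⊥
  | (j+1) => LinearMap.range (dE i j)

/-- the total differential from total degree -1 to total degree 0 -/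
def auxD (dF : ∀ i j, C (i+1) j →ₗ[K] C i j) (dE : ∀ i j, C i j →ₗ[K] C i (j+1)) :
    (∀ j, C (j+1) j) →ₗ[K] (∀ j, C j j) :=
  LinearMap.pi fun j => match j with
    | 0 => dF 0 0 ∘ₗ LinearMap.proj (φ := fun j => C (j+1) j) 0
    | (k+1) => dF (k+1) (k+1) ∘ₗ LinearMap.proj (φ := fun j => C (j+1) j) (k+1) +
        dE (k+1) k ∘ₗ LinearMap.proj (φ := fun j => C (j+1) j) k

theorem auxD_zero (dF : ∀ i j, C (i+1) j →ₗ[K] C i j) (dE : ∀ i j, C i j →ₗ[K] C i (j+1))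
    (u : ∀ j, C (j+1) j) : auxD dF dE u 0 = dF 0 0 (u 0) := rfl
theorem auxD_succ (dF : ∀ i j, C (i+1) j →ₗ[K] C i j) (dE : ∀ i j, C i j →ₗ[K] C i (j+1))
    (u : ∀ j, C (j+1) j) (k : ℕ) :
    auxD dF dE u (k+1) = dF (k+1) (k+1) (u (k+1)) + dE (k+1) k (u k) := rfl

/-- the core dimension estimate -/
theorem aux_core [∀ i j, FiniteDimensional K (C i j)]
    (dF : ∀ i j, C (i+1) j →ₗ[K] C i j) (dE : ∀ i j, C i j →ₗ[K] C i (j+1))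
    (hFF : ∀ i j x, dF i j (dF (i+1) j x) = 0)
    (hEE : ∀ i j x, dE i (j+1) (dE i j x) = 0)
    (hFE : ∀ i j x, dF i (j+1) (dE (i+1) j x) = dE i j (dF i j x))
    (N τ : ℕ) (hτ : τ < N) (hN : ∀ i j, N ≤ j → Subsingleton (C i j))
    (P : Submodule K (C (τ+1) τ)) (Q : Submodule K (C τ τ))
    (hPZ : P ≤ LinearMap.ker (dE (τ+1) τ)) (hQZ : Q ≤ LinearMap.ker (dE τ τ))
    (hQB : auxB dE τ τ ≤ Q) (hPQ : ∀ x ∈ P, dF τ τ x ∈ Q) :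
    ∑ j ∈ Ico (τ+1) N, finrank K (auxB dE (j+1) j) + ∑ j ∈ range τ, finrank K (C (j+1) j)
        + finrank K P
      ≤ ∑ j ∈ range N, finrank K (LinearMap.ker (dF j j)) + finrank K Q
        + ∑ j ∈ range τ, finrank K (LinearMap.ker (dE j j)) := by
  have : FiniteDimensional K (∀ j, C (j+1) j) :=
    aux_pi_finite N (fun j hj => hN _ j hj)
  have : FiniteDimensional K (∀ j, C j j) :=
    aux_pi_finite N (fun j hj => hN _ j hj)
  set D := auxD dF dE with hD
  set Kr := LinearMap.ker D with hKr
  have hiN : ∀ u : (∀ j, C (j+1) j), u ∈ auxHi K (fun j => C (j+1) j) N := by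
    intro u k hk
    have := hN (k+1) k hk
    exact Subsingleton.elim _ _
  let sg : ∀ k, C (k+1) k → (∀ j, C (j+1) j) := fun k y => Pi.single k y
  have sg_same : ∀ k y, sg k y k = y := fun k y => Pi.single_eq_same k y
  have sg_ne : ∀ k y m, m ≠ k → sg k y m = 0 := fun k y m h => Pi.single_eq_of_ne (M := fun j => C (j+1) j) h y
  clear_value sg
  -- Step A
  have stepA : finrank K Kr ≤ ∑ j ∈ range N, finrank K (LinearMap.ker (dF j j)) := by
    rw [aux_lo_sum Kr N]
    have h0 : Kr ⊓ auxLo K (fun j => C (j+1) j) N = ⊥ := by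
      rw [eq_bot_iff]
      rintro u ⟨_, hu⟩
      rw [Submodule.mem_bot]
      funext k
      by_cases hk : k < N
      · exact hu k hk
      · exact hiN u k (by omega)
    rw [h0, finrank_bot, zero_add]
    refine sum_le_sum fun k _ => Submodule.finrank_mono ?_
    rintro _ ⟨u, ⟨hu, hlo⟩, rfl⟩
    have hu' : D u = 0 := hu
    rw [LinearMap.mem_ker, LinearMap.proj_apply]
    cases k with
    | zero => exact congrFun hu' 0
    | succ k =>
      have h1 := congrFun hu' (k+1)
      rw [hD, auxD_succ, hlo k (by omega), map_zero, add_zero] at h1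
      exact h1
  -- Step B
  have stepB : ∑ j ∈ Ico (τ+1) N, finrank K (auxB dE (j+1) j) +
      finrank K (Kr ⊓ auxHi K (fun j => C (j+1) j) (τ+1) : Submodule K _) ≤ finrank K Kr := by
    have h1 : Kr ⊓ auxHi K (fun j => C (j+1) j) N = Kr := inf_eq_left.2 fun u _ => hiN u
    have h2 := aux_hi_sum Kr N
    rw [h1] at h2
    rw [h2, aux_hi_sum Kr (τ+1), ← sum_range_add_sum_Ico _ (show τ+1 ≤ N from hτ), add_comm]
    refine Nat.add_le_add_left (sum_le_sum fun k hk => Submodule.finrank_mono ?_) _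
    obtain ⟨k, rfl⟩ : ∃ k', k = k' + 1 := ⟨k - 1, by have := (mem_Ico.1 hk).1; omega⟩
    rintro _ ⟨y, rfl⟩
    refine ⟨sg (k+1) (dE (k+2) k y) - sg k (dF (k+1) k y), ⟨?_, ?_⟩, ?_⟩
    · change D _ = 0
      funext m
      rcases m with _ | m
      · rw [hD, auxD_zero, Pi.sub_apply, sg_ne (k+1) _ 0 (by omega)]
        rcases k with _ | k
        · rw [sg_same, zero_sub, map_neg, hFF]; simp
        · rw [sg_ne _ _ 0 (by omega)]; simp
      · rw [hD, auxD_succ, Pi.sub_apply, Pi.sub_apply]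
        by_cases e1 : m = k
        · subst e1
          rw [sg_same, sg_same, sg_ne _ _ (m+1) (by omega), sg_ne _ _ m (by omega)]
          simp [hFE]
        · by_cases e2 : m = k + 1
          · subst e2
            rw [sg_same, sg_ne _ _ (k+1) (by omega), sg_ne _ _ _ (by omega), sg_ne _ _ _ (by omega)]
            simp [hEE]
          · by_cases e3 : m + 1 = k
            · subst e3
              rw [sg_same, sg_ne _ _ _ (by omega), sg_ne _ _ _ (by omega), sg_ne _ _ _ (by omega)]
              simp [hFF]
            · rw [sg_ne _ _ _ (by omega), sg_ne _ _ _ (by omega), sg_ne _ _ _ (by omega), sg_ne _ _ _ (by omega)]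
              simp
    · intro m hm
      rw [Pi.sub_apply, sg_ne _ _ _ (by omega), sg_ne _ _ _ (by omega), sub_zero]
    · rw [LinearMap.proj_apply, Pi.sub_apply, sg_same, sg_ne _ _ _ (by omega), sub_zero]
  -- Step C
  let W : Submodule K (∀ j, C (j+1) j) :=
    auxHi K (fun j => C (j+1) j) (τ+1) ⊓ P.comap (LinearMap.proj (R := K) (φ := fun j => C (j+1) j) τ)
  have hW : ∑ j ∈ range τ, finrank K (C (j+1) j) + finrank K P ≤ finrank K W := by
    have h1 : W ⊓ auxHi K (fun j => C (j+1) j) (τ+1) = W := inf_eq_left.2 inf_le_left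
    have h2 := aux_hi_sum W (τ+1)
    rw [h1] at h2
    rw [h2, sum_range_succ]
    refine Nat.add_le_add (sum_le_sum fun k hk => ?_) (Submodule.finrank_mono ?_)
    · rw [← finrank_top K (C (k+1) k)]
      refine Submodule.finrank_mono ?_
      rintro y -
      have hk := mem_range.1 hk
      refine ⟨sg k y, ⟨⟨?_, ?_⟩, ?_⟩, by rw [LinearMap.proj_apply, sg_same]⟩
      · intro m hm
        exact sg_ne _ _ _ (by omega)
      · rw [SetLike.mem_coe, Submodule.mem_comap, LinearMap.proj_apply, sg_ne _ _ _ (by omega)]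
        exact P.zero_mem
      · intro m hm
        exact sg_ne _ _ _ (by omega)
    · intro y hy
      refine ⟨sg τ y, ⟨⟨?_, ?_⟩, ?_⟩, by rw [LinearMap.proj_apply, sg_same]⟩
      · intro m hm
        exact sg_ne _ _ _ (by omega)
      · rw [SetLike.mem_coe, Submodule.mem_comap, LinearMap.proj_apply, sg_same]
        exact hy
      · intro m hm
        exact sg_ne _ _ _ (by omega)
  have hWs := aux_finrank_step W D
  have hWK : finrank K (W ⊓ LinearMap.ker D : Submodule K _) ≤
      finrank K (Kr ⊓ auxHi K (fun j => C (j+1) j) (τ+1) : Submodule K _) :=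
    Submodule.finrank_mono fun u hu => ⟨hu.2, hu.1.1⟩
  -- Step D
  have stepD : finrank K (W.map D) ≤ finrank K Q + ∑ j ∈ range τ, finrank K (LinearMap.ker (dE j j)) := by
    have hle : W.map D ≤ auxHi K (fun j => C j j) (τ+1) := by
      rintro _ ⟨u, ⟨hu, huP⟩, rfl⟩ m hm
      obtain ⟨m, rfl⟩ : ∃ k', m = k' + 1 := ⟨m - 1, by omega⟩
      have huP' : u τ ∈ P := huP
      rw [hD, auxD_succ, hu (m+1) hm, map_zero, zero_add]
      rcases eq_or_lt_of_le (show τ ≤ m by omega) with h | h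
      · subst h
        exact hPZ huP'
      · rw [hu m h, map_zero]
    have h2 := aux_hi_sum (W.map D) (τ+1)
    rw [inf_eq_left.2 hle] at h2
    rw [h2, sum_range_succ, add_comm]
    refine Nat.add_le_add (Submodule.finrank_mono ?_) (sum_le_sum fun k hk => Submodule.finrank_mono ?_)
    · rintro _ ⟨_, ⟨⟨u, ⟨hu, huP⟩, rfl⟩, -⟩, rfl⟩
      have huP' : u τ ∈ P := huP
      rw [LinearMap.proj_apply]
      clear hle h2 hWs hWK hW stepB stepA
      clear_value W
      rcases τ with _ | t
      · rw [hD, auxD_zero]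
        exact hPQ _ huP'
      · rw [hD, auxD_succ]
        exact Q.add_mem (hPQ _ huP') (hQB ⟨_, rfl⟩)
    · rintro _ ⟨_, ⟨⟨u, ⟨hu, huP⟩, rfl⟩, hz⟩, rfl⟩
      rw [LinearMap.mem_ker, LinearMap.proj_apply]
      have hz1 := hz (k+1) le_rfl
      have key : dE k k (D u k) = dF k (k+1) (D u (k+1)) := by
        rw [hD, auxD_succ, map_add, hFF, zero_add, hFE]
        rcases k with _ | k
        · rw [auxD_zero]
        · rw [auxD_succ, map_add, hEE, add_zero]
      rw [key, hz1, map_zero]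
  omega

end AbstractPart

theorem aux_tele (a k : ℕ → ℤ) (h : ∀ e, a e = k (e+1) + k e) (r : ℕ) :
    ∑ e ∈ range r, (-1 : ℤ)^e * a e = k 0 - (-1)^r * k r := by
  induction r with
  | zero => simp
  | succ r ih => rw [sum_range_succ, ih, h, pow_succ]; ring

theorem aux_numeric (c z b κ h : ℕ → ℕ → ℤ) (p q : ℤ) (r L τ : ℕ)
    (hc : ∀ i j, c i j = z i j + b i (j+1)) (hb0 : ∀ i, b i 0 = 0)
    (hh : ∀ i j, h i j = z i j - b i j) (hκ : ∀ i j, c (i+2) j = κ (i+1) j + κ i j)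
    (hκ0 : ∀ i j, r ≤ i → κ i j = 0) (hbi : ∀ i j, r ≤ i → b i j = 0)
    (hbj : ∀ i j, r ≤ j → b i j = 0) (hhL : ∀ i j, L ≤ i → h i j = 0)
    (hLr : L ≤ r) (hτ : τ < r)
    (core : ∑ j ∈ Ico (τ+1) (r+2), b (j+1) j + ∑ j ∈ range τ, c (j+1) j + p ≤
      ∑ j ∈ range (r+2), κ j j + q + ∑ j ∈ range τ, z j j) :
    0 ≤ (∑ i ∈ range L, ∑ j ∈ range (i+1),
      if j < τ ∨ j + 2 ≤ i then (-1 : ℤ)^(i-j) * h i j else 0) +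
      ((q - b τ τ) - (p - b (τ+1) τ)) := by
  -- reindex
  have e1 : (∑ i ∈ range L, ∑ j ∈ range (i+1),
      if j < τ ∨ j + 2 ≤ i then (-1 : ℤ)^(i-j) * h i j else 0) =
      ∑ j ∈ range (r+2), ∑ e ∈ range (r+2),
        if j < τ ∨ 2 ≤ e then (-1 : ℤ)^e * h (j+e) j else 0 := by
    have s1 : (∑ i ∈ range L, ∑ j ∈ range (i+1),
        if j < τ ∨ j + 2 ≤ i then (-1 : ℤ)^(i-j) * h i j else 0) =
        ∑ i ∈ range (r+2), ∑ j ∈ range (i+1),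
        if j < τ ∨ 2 ≤ i - j then (-1 : ℤ)^(i-j) * h (j + (i-j)) j else 0 := by
      rw [← sum_subset (s₁ := range L) (s₂ := range (r+2))]
      · refine sum_congr rfl fun i _ => sum_congr rfl fun j hj => ?_
        have hj := mem_range.1 hj
        have e2 : j + (i - j) = i := by omega
        have e3 : (2 ≤ i - j) ↔ (j + 2 ≤ i) := by omega
        simp only [e2, e3]
      · intro x hx
        rw [mem_range] at *
        omega
      · intro i _ hi
        refine sum_eq_zero fun j hj => ?_
        have hj := mem_range.1 hj
        rw [mem_range] at hi
        rw [hhL _ _ (by omega)]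
        simp
    rw [s1, sum_range_diag_flip (r+2)
      (fun j e => if j < τ ∨ 2 ≤ e then (-1 : ℤ)^e * h (j+e) j else 0)]
    refine sum_congr rfl fun j hj => ?_
    apply sum_subset
    · intro x hx
      rw [mem_range] at *
      omega
    · intro e _ he
      rw [mem_range] at he
      rw [hhL _ _ (by omega)]
      simp
  have e2 : ∀ j, (∑ e ∈ range (r+2), if j < τ ∨ 2 ≤ e then (-1 : ℤ)^e * h (j+e) j else 0) =
      ∑ e ∈ range r, (-1 : ℤ)^e * c (j+e+2) j
      - ∑ e ∈ range r, (-1 : ℤ)^e * (b (j+e+2) (j+1) + b (j+e+2) j)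
      + if j < τ then h j j - h (j+1) j else 0 := by
    intro j
    rw [sum_range_succ', sum_range_succ', ← sum_sub_distrib, add_assoc]
    congr 1
    · refine sum_congr rfl fun e _ => ?_
      rw [if_pos (by omega), hh, hc, show j + (e+1+1) = j+e+2 by ring, pow_succ, pow_succ]
      ring
    · by_cases hj : j < τ
      · simp [hj]; ring
      · simp [hj]
  have e3 : ∀ j, ∑ e ∈ range r, (-1 : ℤ)^e * c (j+e+2) j = κ j j := by
    intro j
    rw [aux_tele (fun e => c (j+e+2) j) (fun e => κ (j+e) j) (fun e => hκ (j+e) j)]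
    simp [hκ0 (j+r) j (by omega)]
  have e4 : ∑ j ∈ range (r+2), ∑ e ∈ range r, (-1 : ℤ)^e * (b (j+e+2) (j+1) + b (j+e+2) j)
      = ∑ j ∈ range (r+2), b (j+1) j := by
    rw [sum_comm]
    simp_rw [← mul_sum]
    rw [aux_tele _ (fun e => ∑ j ∈ range (r+2), b (j+(e+1)) j)]
    · simp only [zero_add]
      rw [sum_eq_zero (s := range (r+2)) (f := fun j => b (j+(r+1)) j)]
      · simp
      · intro j _
        exact hbi _ _ (by omega)
    · intro e
      rw [sum_add_distrib, add_comm]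
      congr 1
      have := sum_range_succ' (fun j => b (j+(e+1)) j) (r+2)
      rw [sum_range_succ, hb0, hbj _ (r+2) (by omega)] at this
      simp only [add_zero] at this
      rw [this]
      refine sum_congr rfl fun j _ => ?_
      congr 1
      ring
  have e5 : (∑ j ∈ range (r+2), if j < τ then h j j - h (j+1) j else 0) =
      ∑ j ∈ range τ, (h j j - h (j+1) j) := by
    rw [← sum_filter]
    congr 1
    ext j
    simp only [mem_filter, mem_range]
    omega
  have e6 : ∑ j ∈ range (r+2), b (j+1) j = ∑ j ∈ range τ, b (j+1) j + b (τ+1) τ +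
      ∑ j ∈ Ico (τ+1) (r+2), b (j+1) j := by
    rw [← sum_range_succ, sum_range_add_sum_Ico _ (show τ+1 ≤ r+2 by omega)]
  have e7 : ∑ j ∈ range τ, (h j j - h (j+1) j) + ∑ j ∈ range τ, c (j+1) j
      = ∑ j ∈ range τ, z j j + ∑ j ∈ range τ, b (j+1) j + b τ τ := by
    have t := sum_range_sub (fun j => b j j) τ
    rw [hb0, sub_zero] at t
    rw [← t, ← sum_add_distrib, ← sum_add_distrib, ← sum_add_distrib]
    refine sum_congr rfl fun j _ => ?_
    rw [hh, hh, hc]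
    ring
  rw [e1]
  simp_rw [e2]
  rw [sum_add_distrib, sum_sub_distrib, e4, e5, e6]
  simp_rw [e3]
  linarith

section ConcretePart

theorem aux_homogZ_nonneg {z : ℤ} (hz : 0 ≤ z) :
    homogZ K n z = MvPolynomial.homogeneousSubmodule (Fin n) K z.toNat := by
  simp [homogZ, hz]

theorem aux_homogZ_neg {z : ℤ} (hz : z < 0) : homogZ K n z = ⊥ := by
  have : ¬ (0 ≤ z) := by omega
  simp [homogZ, this]

theorem aux_homogZ_mul {s t : ℤ} {a b : PolyS K n} (ha : a ∈ homogZ K n s) (hb : b ∈ homogZ K n t) :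
    a * b ∈ homogZ K n (s + t) := by
  by_cases hs : 0 ≤ s
  · by_cases ht : 0 ≤ t
    · rw [aux_homogZ_nonneg hs, mem_homogeneousSubmodule] at ha
      rw [aux_homogZ_nonneg ht, mem_homogeneousSubmodule] at hb
      rw [aux_homogZ_nonneg (by omega), mem_homogeneousSubmodule, Int.toNat_add hs ht]
      exact ha.mul hb
    · rw [aux_homogZ_neg (by omega), Submodule.mem_bot] at hb
      rw [hb, mul_zero]
      exact Submodule.zero_mem _
  · rw [aux_homogZ_neg (by omega), Submodule.mem_bot] at ha
    rw [ha, zero_mul]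
    exact Submodule.zero_mem _

theorem aux_homogZ_finite (z : ℤ) : FiniteDimensional K (homogZ K n z) := by
  by_cases hz : 0 ≤ z
  · rw [aux_homogZ_nonneg hz]
    exact Module.Finite.iff_fg.2 (homogeneousSubmodule_fg _ _ _)
  · rw [aux_homogZ_neg (by omega)]
    infer_instance

/-- the homogeneous component of integer degree -/
def auxComp (K : Type) [Field K] (n : ℕ) (z : ℤ) : PolyS K n →ₗ[K] PolyS K n :=
  if 0 ≤ z then homogeneousComponent z.toNat else 0

theorem auxComp_mem (z : ℤ) (p : PolyS K n) : auxComp K n z p ∈ homogZ K n z := by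
  unfold auxComp
  split_ifs with h
  · rw [aux_homogZ_nonneg h]
    exact homogeneousComponent_mem _ _
  · exact Submodule.zero_mem _

theorem auxComp_of_mem {z k : ℤ} {p : PolyS K n} (hp : p ∈ homogZ K n k) :
    auxComp K n z p = if z = k then p else 0 := by
  by_cases hk : 0 ≤ k
  · rw [aux_homogZ_nonneg hk] at hp
    unfold auxComp
    by_cases hz : 0 ≤ z
    · rw [if_pos hz, homogeneousComponent_of_mem hp]
      have : z.toNat = k.toNat ↔ z = k := by omega
      simp only [this]
    · rw [if_neg hz, if_neg (by omega)]
      rfl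
  · rw [aux_homogZ_neg (by omega), Submodule.mem_bot] at hp
    simp [hp]

theorem auxComp_mul {s : ℤ} (t : ℤ) {a : PolyS K n} (ha : a ∈ homogZ K n s) (w : PolyS K n) :
    auxComp K n (s + t) (a * w) = a * auxComp K n t w := by
  induction w using MvPolynomial.induction_on' with
  | monomial d c =>
    have hm : (monomial d c : PolyS K n) ∈ homogZ K n (d.degree : ℤ) := by
      rw [aux_homogZ_nonneg (by omega), mem_homogeneousSubmodule]
      exact isHomogeneous_monomial c (by simp)
    rw [auxComp_of_mem hm, auxComp_of_mem (aux_homogZ_mul ha hm)]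
    by_cases h : t = (d.degree : ℤ)
    · simp [h]
    · rw [if_neg h, if_neg (by omega), mul_zero]
  | add p q hp hq => rw [mul_add, map_add, hp, hq, map_add, mul_add]

theorem aux_graded_preimage {m k : ℕ} (A : Matrix (Fin m) (Fin k) (PolyS K n))
    (a : Fin k → ℤ) (b : Fin m → ℤ) (hA : ∀ p q, A p q ∈ homogZ K n (a q - b p)) (l : ℤ)
    (w : Fin k → PolyS K n) (hv : ∀ p, A.mulVec w p ∈ homogZ K n (l - b p)) :
    A.mulVec (fun q => auxComp K n (l - a q) (w q)) = A.mulVec w := by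
  funext p
  have h1 := auxComp_of_mem (z := l - b p) (hv p)
  rw [if_pos rfl] at h1
  rw [← h1]
  simp only [Matrix.mulVec, dotProduct, map_sum]
  refine sum_congr rfl fun q _ => ?_
  rw [← auxComp_mul _ (hA p q)]
  congr 2
  ring

theorem aux_mem_freePiece {r : ℕ} {dg : Fin r → ℤ} {l : ℤ} {v : Fin r → PolyS K n} :
    v ∈ freePiece dg l ↔ ∀ p, v p ∈ homogZ K n (l - dg p) := by
  simp [freePiece, Submodule.mem_pi]

instance aux_freePiece_finite {r : ℕ} (dg : Fin r → ℤ) (l : ℤ) :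
    FiniteDimensional K (freePiece (K := K) (n := n) dg l) := by
  have := fun p => aux_homogZ_finite (K := K) (n := n) (l - dg p)
  let f : freePiece (K := K) (n := n) dg l →ₗ[K] (∀ p, homogZ K n (l - dg p)) :=
    LinearMap.pi fun p => LinearMap.codRestrict _ (LinearMap.proj p ∘ₗ Submodule.subtype _)
      (fun v => aux_mem_freePiece.1 v.2 p)
  refine Module.Finite.of_injective f ?_
  intro v w h
  ext1
  funext p
  exact congrArg Subtype.val (congrFun h p)

theorem aux_mulVec_mem {m k : ℕ} (A : Matrix (Fin m) (Fin k) (PolyS K n))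
    (a : Fin k → ℤ) (b : Fin m → ℤ) (hA : ∀ p q, A p q ∈ homogZ K n (a q - b p)) (l : ℤ)
    (w : Fin k → PolyS K n) (hw : w ∈ freePiece a l) : A.mulVec w ∈ freePiece b l := by
  rw [aux_mem_freePiece] at *
  intro p
  change (∑ q, A p q * w q) ∈ homogZ K n (l - b p)
  refine Submodule.sum_mem _ fun q _ => ?_
  have := aux_homogZ_mul (hA p q) (hw q)
  rwa [show a q - b p + (l - a q) = l - b p by ring] at this

/-- the degree `l` part of the differential of `E` -/
def auxE (E : CoComplex K n) (j : ℕ) (l : ℤ) :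
    freePiece (K := K) (n := n) (E.deg j) l →ₗ[K] freePiece (K := K) (n := n) (E.deg (j+1)) l :=
  LinearMap.restrict ((E.dd j).mulVecLin.restrictScalars K)
    (fun w hw => aux_mulVec_mem (E.dd j) (E.deg j) (E.deg (j+1)) (E.isHomog j) l w hw)

theorem auxE_coe (E : CoComplex K n) (j : ℕ) (l : ℤ) (v : freePiece (K := K) (n := n) (E.deg j) l) :
    (auxE E j l v : Fin (E.rk (j+1)) → PolyS K n) = (E.dd j).mulVec v := rfl

theorem auxE_auxE (E : CoComplex K n) (j : ℕ) (l : ℤ) (v : freePiece (K := K) (n := n) (E.deg j) l) :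
    auxE E (j+1) l (auxE E j l v) = 0 := by
  ext1
  rw [auxE_coe, auxE_coe, Matrix.mulVec_mulVec, E.isComplex, Matrix.zero_mulVec]
  rfl

/-- the degree `l` part of the coboundaries of `E` -/
def auxEB (E : CoComplex K n) : (j : ℕ) → (l : ℤ) →
    Submodule K (freePiece (K := K) (n := n) (E.deg j) l)
  | 0, _ => ⊥
  | (j+1), l => LinearMap.range (auxE E j l)

theorem auxEB_le (E : CoComplex K n) (j : ℕ) (l : ℤ) : auxEB E j l ≤ LinearMap.ker (auxE E j l) := by
  cases j with
  | zero => exact bot_le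
  | succ j =>
    rintro _ ⟨v, rfl⟩
    exact auxE_auxE E j l v

theorem aux_cohomDim (E : CoComplex K n) (j : ℕ) (l : ℤ) :
    (cohomDim E j l : ℤ) = (finrank K (LinearMap.ker (auxE E j l)) : ℤ) - finrank K (auxEB E j l) := by
  have h1 : E.kerPiece j l = (LinearMap.ker (auxE E j l)).map (Submodule.subtype _) := by
    ext v
    constructor
    · rintro ⟨hv, hv2⟩
      refine ⟨⟨v, hv2⟩, ?_, rfl⟩
      rw [SetLike.mem_coe, LinearMap.mem_ker]
      ext1
      exact hv
    · rintro ⟨w, hw, rfl⟩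
      exact ⟨congrArg Subtype.val (LinearMap.mem_ker.1 hw), w.2⟩
  have h2 : E.kerPiece j l ⊓ E.imSub j = (auxEB E j l).map (Submodule.subtype _) := by
    apply le_antisymm
    · rintro v ⟨⟨_, hv⟩, hi⟩
      cases j with
      | zero =>
        have : v = 0 := hi
        rw [this]
        exact Submodule.zero_mem _
      | succ j =>
        obtain ⟨w, rfl⟩ := hi
        have hv' := aux_mem_freePiece.1 hv
        have hg := aux_graded_preimage (E.dd j) (E.deg j) (E.deg (j+1)) (E.isHomog j) l w hv'
        refine ⟨auxE E j l ⟨fun q => auxComp K n (l - E.deg j q) (w q), ?_⟩, ⟨_, rfl⟩, ?_⟩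
        · exact aux_mem_freePiece.2 fun q => auxComp_mem _ _
        · rw [Submodule.subtype_apply, auxE_coe]
          exact hg
    · refine le_inf ?_ ?_
      · rw [h1]
        exact Submodule.map_mono (auxEB_le E j l)
      · cases j with
        | zero =>
          rintro _ ⟨w, hw, rfl⟩
          have : w = 0 := hw
          rw [this]
          exact Submodule.zero_mem _
        | succ j =>
          rintro _ ⟨_, ⟨w, rfl⟩, rfl⟩
          exact ⟨w, rfl⟩
  have hfin : FiniteDimensional K (E.kerPiece j l) := by
    rw [h1]
    infer_instance
  have h3 := Submodule.finrank_quotient_add_finrank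
    ((E.imSub j).comap (E.kerPiece j l).subtype)
  have h4 := Submodule.finrank_map_subtype_eq (E.kerPiece j l)
    ((E.imSub j).comap (E.kerPiece j l).subtype)
  rw [Submodule.map_comap_subtype, h2, Submodule.finrank_map_subtype_eq] at h4
  have h5 : finrank K (E.kerPiece j l) = finrank K (LinearMap.ker (auxE E j l)) := by
    rw [h1, Submodule.finrank_map_subtype_eq]
  rw [← h4, h5] at h3
  unfold cohomDim
  omega

theorem aux_finrank_pi {ι : Type} [Fintype ι] {V : ι → Type} [∀ i, AddCommGroup (V i)]
    [∀ i, Module K (V i)] [∀ i, FiniteDimensional K (V i)] (S : ∀ i, Submodule K (V i)) :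
    finrank K (Submodule.pi Set.univ S) = ∑ i, finrank K (S i) := by
  let f : (∀ i, S i) →ₗ[K] (∀ i, V i) := LinearMap.pi fun i => (S i).subtype ∘ₗ LinearMap.proj i
  have hf : Function.Injective f := by
    intro v w h
    funext i
    exact Subtype.ext (congrFun h i)
  have hr : LinearMap.range f = Submodule.pi Set.univ S := by
    ext v
    rw [Submodule.mem_pi]
    constructor
    · rintro ⟨w, rfl⟩ i _
      exact (w i).2
    · intro h
      exact ⟨fun i => ⟨v i, h i trivial⟩, rfl⟩
  rw [← hr, LinearMap.finrank_range_of_inj hf, Module.finrank_pi_fintype]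

variable (F : FreeComplex K n) (E : CoComplex K n)

/-- the degree zero part of `F_i ⊗ E^j` -/
abbrev AuxC (i j : ℕ) : Type := ∀ p : Fin (F.rk i), freePiece (K := K) (n := n) (E.deg j) (-(F.deg i p))

/-- the differential in the `E` direction -/
def auxdE (i j : ℕ) : AuxC F E i j →ₗ[K] AuxC F E i (j+1) :=
  LinearMap.pi fun p => auxE E j (-(F.deg i p)) ∘ₗ LinearMap.proj p

theorem auxdE_apply (i j : ℕ) (x : AuxC F E i j) (p : Fin (F.rk i)) :
    auxdE F E i j x p = auxE E j (-(F.deg i p)) (x p) := rfl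

theorem auxdF_mem (i j : ℕ) (x : AuxC F E (i+1) j) (p : Fin (F.rk i)) :
    (∑ q, F.dd i p q • (x q : Fin (E.rk j) → PolyS K n)) ∈ freePiece (E.deg j) (-(F.deg i p)) := by
  refine Submodule.sum_mem _ fun q _ => ?_
  rw [aux_mem_freePiece]
  intro r
  have := aux_homogZ_mul (F.isHomog i p q) (aux_mem_freePiece.1 (x q).2 r)
  rw [show F.deg (i+1) q - F.deg i p + (-(F.deg (i+1) q) - E.deg j r) =
    -(F.deg i p) - E.deg j r by ring] at this
  exact this

/-- the differential in the `F` direction -/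
def auxdF (i j : ℕ) : AuxC F E (i+1) j →ₗ[K] AuxC F E i j where
  toFun x p := ⟨∑ q, F.dd i p q • (x q : Fin (E.rk j) → PolyS K n), auxdF_mem F E i j x p⟩
  map_add' x y := by
    funext p
    ext1
    simp [smul_add, sum_add_distrib]
  map_smul' c x := by
    funext p
    ext1
    simp [smul_sum, smul_comm c]

theorem auxdF_coe (i j : ℕ) (x : AuxC F E (i+1) j) (p : Fin (F.rk i)) :
    (auxdF F E i j x p : Fin (E.rk j) → PolyS K n) =
      ∑ q, F.dd i p q • (x q : Fin (E.rk j) → PolyS K n) := rfl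

theorem auxdF_col (i j : ℕ) (x : AuxC F E (i+1) j) (r : Fin (E.rk j)) :
    (fun p => (auxdF F E i j x p : Fin (E.rk j) → PolyS K n) r) =
      (F.dd i).mulVec (fun q => (x q : Fin (E.rk j) → PolyS K n) r) := by
  funext p
  simp [auxdF_coe, Matrix.mulVec, dotProduct]

theorem auxC_ext {i j : ℕ} {x y : AuxC F E i j}
    (h : ∀ r, (fun p => (x p : Fin (E.rk j) → PolyS K n) r) =
      (fun p => (y p : Fin (E.rk j) → PolyS K n) r)) : x = y := by
  funext p
  ext1
  funext r
  exact congrFun (h r) p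

theorem auxdF_auxdF (i j : ℕ) (x : AuxC F E (i+2) j) :
    auxdF F E i j (auxdF F E (i+1) j x) = 0 := by
  apply auxC_ext
  intro r
  rw [auxdF_col, auxdF_col, Matrix.mulVec_mulVec, F.isComplex, Matrix.zero_mulVec]
  rfl

theorem auxdE_auxdE (i j : ℕ) (x : AuxC F E i j) :
    auxdE F E i (j+1) (auxdE F E i j x) = 0 := by
  funext p
  exact auxE_auxE _ _ _ _

theorem auxdF_auxdE (i j : ℕ) (x : AuxC F E (i+1) j) :
    auxdF F E i (j+1) (auxdE F E (i+1) j x) = auxdE F E i j (auxdF F E i j x) := by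
  funext p
  ext1
  rw [auxdF_coe, auxdE_apply, auxE_coe, auxdF_coe, ← Matrix.mulVecLin_apply, map_sum]
  refine sum_congr rfl fun q _ => ?_
  rw [map_smul]
  rfl

theorem auxdF_exact (hres : IsResolution F) (i j : ℕ) :
    LinearMap.ker (auxdF F E i j) = LinearMap.range (auxdF F E (i+1) j) := by
  apply le_antisymm
  · intro x hx
    have hx' : auxdF F E i j x = 0 := hx
    have h1 : ∀ r : Fin (E.rk j), ∃ w, (F.dd (i+1)).mulVec w =
        (fun q => (x q : Fin (E.rk j) → PolyS K n) r) := by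
      intro r
      have : (fun q => (x q : Fin (E.rk j) → PolyS K n) r) ∈
          LinearMap.ker ((F.dd i).mulVecLin) := by
        rw [LinearMap.mem_ker, Matrix.mulVecLin_apply, ← auxdF_col, hx']
        rfl
      rw [hres i] at this
      exact this
    choose w hw using h1
    refine ⟨fun s => ⟨fun r => auxComp K n (-(E.deg j r) - F.deg (i+2) s) (w r s), ?_⟩, ?_⟩
    · rw [aux_mem_freePiece]
      intro r
      rw [show -(F.deg (i+2) s) - E.deg j r = -(E.deg j r) - F.deg (i+2) s by ring]
      exact auxComp_mem _ _
    · apply auxC_ext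
      intro r
      rw [auxdF_col, ← hw r]
      refine aux_graded_preimage (F.dd (i+1)) (F.deg (i+2)) (F.deg (i+1)) (F.isHomog (i+1))
        (-(E.deg j r)) (w r) ?_
      intro q
      rw [hw r, show -(E.deg j r) - F.deg (i+1) q = -(F.deg (i+1) q) - E.deg j r by ring]
      exact aux_mem_freePiece.1 (x q).2 r
  · rintro _ ⟨y, rfl⟩
    exact auxdF_auxdF F E i j y

theorem auxC_sub_i {i : ℕ} (j : ℕ) (hi : F.len < i) : Subsingleton (AuxC F E i j) := by
  have : IsEmpty (Fin (F.rk i)) := by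
    rw [F.rk_eq_zero i hi]
    infer_instance
  infer_instance

theorem auxC_sub_j (i : ℕ) {j : ℕ} (hj : E.len < j) : Subsingleton (AuxC F E i j) := by
  have : IsEmpty (Fin (E.rk j)) := by
    rw [E.rk_eq_zero j hj]
    infer_instance
  infer_instance

theorem aux_ker_dE (i j : ℕ) : LinearMap.ker (auxdE F E i j) =
    Submodule.pi Set.univ (fun p => LinearMap.ker (auxE E j (-(F.deg i p)))) := by
  ext x
  rw [Submodule.mem_pi, LinearMap.mem_ker]
  constructor
  · intro h p _
    exact congrFun h p
  · intro h
    funext p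
    exact h p trivial

theorem auxB_eq (i j : ℕ) : auxB (auxdE F E) i j =
    Submodule.pi Set.univ (fun p => auxEB E j (-(F.deg i p))) := by
  ext x
  rw [Submodule.mem_pi]
  cases j with
  | zero =>
    constructor
    · intro h p _
      exact congrFun (show x = 0 from h) p
    · intro h
      change x = 0
      funext p
      exact h p trivial
  | succ j =>
    constructor
    · rintro ⟨y, rfl⟩ p _
      exact ⟨y p, rfl⟩
    · intro h
      choose y hy using fun p => h p trivial
      exact ⟨y, funext hy⟩

/-- partial truncation: cocycles in degrees `≤ d`, coboundaries in degrees `> d`. -/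
def auxP (d : ℤ) (i j : ℕ) : Submodule K (AuxC F E i j) :=
  Submodule.pi Set.univ (fun p => if F.deg i p ≤ d then LinearMap.ker (auxE E j (-(F.deg i p)))
    else auxEB E j (-(F.deg i p)))

theorem auxP_le (d : ℤ) (i j : ℕ) : auxP F E d i j ≤ LinearMap.ker (auxdE F E i j) := by
  rw [aux_ker_dE]
  apply Submodule.pi_mono
  intro p _
  split_ifs
  · exact le_rfl
  · exact auxEB_le _ _ _

theorem auxB_le_auxP (d : ℤ) (i j : ℕ) : auxB (auxdE F E) i j ≤ auxP F E d i j := by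
  rw [auxB_eq]
  apply Submodule.pi_mono
  intro p _
  split_ifs
  · exact auxEB_le _ _ _
  · exact le_rfl

theorem auxP_finrank (d : ℤ) (i j : ℕ) :
    (finrank K (auxP F E d i j) : ℤ) - finrank K (auxB (auxdE F E) i j) =
      ∑ p ∈ Finset.univ.filter (fun p => F.deg i p ≤ d), (cohomDim E j (-(F.deg i p)) : ℤ) := by
  rw [auxB_eq, auxP, aux_finrank_pi, aux_finrank_pi, sum_filter]
  push_cast
  rw [← sum_sub_distrib]
  refine sum_congr rfl fun p _ => ?_
  by_cases hp : F.deg i p ≤ d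
  · rw [if_pos hp, if_pos hp, aux_cohomDim]
  · rw [if_neg hp, if_neg hp, sub_self]

theorem aux_h_eq (i j : ℕ) :
    ∑ p : Fin (F.rk i), (cohomDim E j (-(F.deg i p)) : ℤ) =
    (finrank K (LinearMap.ker (auxdE F E i j)) : ℤ) - finrank K (auxB (auxdE F E) i j) := by
  rw [auxB_eq, aux_ker_dE, aux_finrank_pi, aux_finrank_pi]
  push_cast
  rw [← sum_sub_distrib]
  exact sum_congr rfl fun p _ => aux_cohomDim _ _ _

theorem auxP_dF (hmin : IsMinimal F) (c : ℤ) (i j : ℕ) (x : AuxC F E (i+1) j)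
    (hx : x ∈ auxP F E (c+1) (i+1) j) : auxdF F E i j x ∈ auxP F E c i j := by
  have hxZ := auxP_le F E _ _ _ hx
  rw [auxP, Submodule.mem_pi] at hx ⊢
  intro p _
  split_ifs with hp
  · rw [LinearMap.mem_ker, ← auxdE_apply, ← auxdF_auxdE, LinearMap.mem_ker.1 hxZ, map_zero]
    rfl
  · -- all contributions are coboundaries
    have key : ∀ q, F.dd i p q ≠ 0 → x q ∈ auxEB E j (-(F.deg (i+1) q)) := by
      intro q hq
      have hxq := hx q trivial
      rw [if_neg] at hxq
      · exact hxq
      · intro hqc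
        apply hq
        rcases lt_or_eq_of_le (show F.deg (i+1) q ≤ F.deg i p by omega) with h | h
        · have := F.isHomog i p q
          rw [aux_homogZ_neg (by omega)] at this
          exact this
        · exact hmin i p q h
    cases j with
    | zero =>
      change _ = _
      ext1
      rw [auxdF_coe]
      refine sum_eq_zero fun q _ => ?_
      by_cases hq : F.dd i p q = 0
      · rw [hq, zero_smul]
      · have : x q = 0 := key q hq
        rw [this]
        simp
    | succ j =>
      have : ∀ q, ∃ y : freePiece (K := K) (n := n) (E.deg j) (-(F.deg (i+1) q)),
          F.dd i p q ≠ 0 → auxE E j _ y = x q := by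
        intro q
        by_cases hq : F.dd i p q = 0
        · exact ⟨0, fun h => absurd hq h⟩
        · obtain ⟨y, hy⟩ := key q hq
          exact ⟨y, fun _ => hy⟩
      choose y hy using this
      refine ⟨auxdF F E i j y p, ?_⟩
      rw [← auxdE_apply, ← auxdF_auxdE]
      ext1
      rw [auxdF_coe, auxdF_coe]
      refine sum_congr rfl fun q _ => ?_
      by_cases hq : F.dd i p q = 0
      · rw [hq, zero_smul, zero_smul]
      · rw [auxdE_apply, hy q hq]

end ConcretePart

/-- Fix `τ : ℕ` and a degree bound `c`. If `F` is a *minimal*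
graded free resolution of a finitely generated graded `S`-module and
`E : 0 → E⁰ → ⋯ → Eⁿ → 0` is any complex of graded free `S`-modules with
cohomology table `γ_{j,d} = dim_K (H^j E)_d`, then `⟨β(F), γ⟩_{c,τ} ≥ 0`. -/
theorem pairingMod_nonneg (K : Type) [Field K] (n : ℕ)
    (F : FreeComplex K n) (hres : IsResolution F) (hmin : IsMinimal F)
    (E : CoComplex K n) (hE : E.len ≤ n) (c : ℤ) (τ : ℕ) :
    0 ≤ pairingMod F E c τ := by
  set r : ℕ := F.len + E.len + τ + 3 with hr
  have core := aux_core (auxdF F E) (auxdE F E) (auxdF_auxdF F E) (auxdE_auxdE F E)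
    (auxdF_auxdE F E) (r+2) τ (by omega) (fun i j hj => auxC_sub_j F E i (by omega))
    (auxP F E (c+1) (τ+1) τ) (auxP F E c τ τ) (auxP_le F E _ _ _) (auxP_le F E _ _ _)
    (auxB_le_auxP F E _ _ _) (auxP_dF F E hmin c τ τ)
  have num := aux_numeric (fun i j => (finrank K (AuxC F E i j) : ℤ))
    (fun i j => (finrank K (LinearMap.ker (auxdE F E i j)) : ℤ))
    (fun i j => (finrank K (auxB (auxdE F E) i j) : ℤ))
    (fun i j => (finrank K (LinearMap.ker (auxdF F E i j)) : ℤ))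
    (fun i j => ∑ p : Fin (F.rk i), (cohomDim E j (-(F.deg i p)) : ℤ))
    (finrank K (auxP F E (c+1) (τ+1) τ)) (finrank K (auxP F E c τ τ)) r (F.len+1) τ
    ?_ ?_ (aux_h_eq F E) ?_ ?_ ?_ ?_ ?_ (by omega) (by omega) (by exact_mod_cast core)
  · rw [auxP_finrank, auxP_finrank] at num
    unfold pairingMod
    have e2 : ∀ f : ℕ → ℤ, ∑ ε ∈ range 2, f ε = f 0 + f 1 :=
      fun f => by simp [sum_range_succ]
    rw [e2, pow_zero, pow_one, one_mul, neg_one_mul, ← sub_eq_add_neg]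
    simp only [Nat.cast_zero, Nat.cast_one, add_zero]
    exact num
  · intro i j
    have := LinearMap.finrank_range_add_finrank_ker (auxdE F E i j)
    change _ = _ + ((finrank K (LinearMap.range (auxdE F E i j)) : ℕ) : ℤ)
    omega
  · intro i
    change ((finrank K (⊥ : Submodule K (AuxC F E i 0)) : ℕ) : ℤ) = 0
    simp
  · intro i j
    have := LinearMap.finrank_range_add_finrank_ker (auxdF F E (i+1) j)
    rw [← auxdF_exact F E hres i j] at this
    change _ + _ = finrank K (AuxC F E (i+2) j) at this
    omega
  · intro i j hi
    have := auxC_sub_i F E (i := i+1) j (by omega)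
    rw [Module.finrank_zero_of_subsingleton]
    rfl
  · intro i j hi
    have := auxC_sub_i F E (i := i) j (by omega)
    rw [Module.finrank_zero_of_subsingleton]
    rfl
  · intro i j hj
    have := auxC_sub_j F E i (j := j) (by omega)
    rw [Module.finrank_zero_of_subsingleton]
    rfl
  · intro i j hi
    have : IsEmpty (Fin (F.rk i)) := by
      rw [F.rk_eq_zero i (by omega)]
      infer_instance
    simp

end
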